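/- Let k3, k5, k7, C1, d1, d2, d3 be positive reals with K1 = C1·k7 − k3·k5 > 0, K2 = 1 + C1·k3/K1, and assume k5·K2 − C1 > 0. Then the function ρ ↦ det E(ρ) is strictly decreasing on [0, ∞). -/

import Mathlib

open Matrix

/-- under the stability condition k5·K2 − C1 > 0, the determinant
of the Fourier-mode matrix E(ρ) is strictly decreasing in ρ on [0, ∞). -/
theorem microtubule_det_strictAnti
    (k3 k5 k7 C1 d1 d2 d3 K1 K2 : ℝ)
    (hk3 : 0 < k3) (hk5 : 0 < k5) (hk7 : 0 < k7) (hC1 : 0 < C1)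
    (hd1 : 0 < d1) (hd2 : 0 < d2) (hd3 : 0 < d3)
    (hK1 : K1 = C1 * k7 - k3 * k5) (hK1pos : 0 < K1)
    (hK2 : K2 = 1 + C1 * k3 / K1)
    (hstab : 0 < k5 * K2 - C1) :
    StrictAntiOn
      (fun ρ : ℝ =>
        (!![-k7 - d1 * ρ, k5, 0;
            k7, -k5 - d2 * ρ, 1;
            -k3, C1, -K2 - d3 * ρ] : Matrix (Fin 3) (Fin 3) ℝ).det)
      (Set.Ici 0) := by
  have hK2pos : 0 < K2 := by rw [hK2]; positivity
  clear hK2 hK1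
  intro x hx y hy hxy
  have hx0 : 0 ≤ x := hx
  have hy0 : 0 ≤ y := hy
  have h0 : 0 < y - x := sub_pos.mpr hxy
  simp only [Matrix.det_fin_three, Matrix.of_apply, Matrix.cons_val]
  rw [← sub_pos]
  have key : 0 < (y - x) * (d1 * d2 * d3 * (x ^ 2 + x * y + y ^ 2)
      + (d1 * d2 * K2 + d1 * d3 * k5 + d2 * d3 * k7) * (x + y)
      + (d1 * (k5 * K2 - C1) + d2 * k7 * K2)) := by
    positivity
  linarith [key]
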